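/- Let (X,d) be a metric space, μ a Borel measure on X, o ∈ X, and C > 0 a real constant such that μ(B_r(o)) ≤ C r² for every r > 0, where B_r(o) is the open ball of radius r centered at o. For a natural number L ≥ 1 define g_L : X → ℝ by g_L(x) = 1/(L · d(o,x)) if e^L ≤ d(o,x) ≤ e^{2L}, and g_L(x) = 0 otherwise. Then ∫_X g_L² dμ ≤ C e² / L. -/

import Mathlib

open MeasureTheory
open scoped ENNReal

/-- A quadratic bound for the measure of open balls passes to closed balls. -/
lemma measure_closedBall_le_of_measure_ball_le {X : Type*} [PseudoMetricSpace X]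
    [MeasurableSpace X] {μ : Measure X} {o : X} {C : ℝ}
    (hμ : ∀ r : ℝ, 0 < r → μ (Metric.ball o r) ≤ ENNReal.ofReal (C * r ^ 2))
    {r : ℝ} (hr : 0 ≤ r) : μ (Metric.closedBall o r) ≤ ENNReal.ofReal (C * r ^ 2) := by
  have hcont : Continuous fun s : ℝ => ENNReal.ofReal (C * s ^ 2) :=
    ENNReal.continuous_ofReal.comp (by fun_prop)
  refine ge_of_tendsto (hcont.continuousWithinAt (s := Set.Ioi r) (x := r)) ?_
  filter_upwards [self_mem_nhdsWithin] with s hs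
  exact (measure_mono (Metric.closedBall_subset_ball hs)).trans (hμ s (hr.trans_lt hs))

/-- A number between `e^L` and `e^{2L}` lies between two consecutive powers of `e`. -/
lemma exists_exp_le_le_exp_succ {L : ℕ} (hL : 1 ≤ L) {d : ℝ} (h₁ : Real.exp L ≤ d)
    (h₂ : d ≤ Real.exp (2 * L)) :
    ∃ k ∈ Finset.range L, Real.exp (L + k) ≤ d ∧ d ≤ Real.exp (L + k + 1) := by
  have hd : 0 < d := (Real.exp_pos _).trans_le h₁
  rw [← Real.le_log_iff_exp_le hd] at h₁
  rw [← Real.log_le_iff_le_exp hd] at h₂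
  simp_rw [← Real.le_log_iff_exp_le hd, ← Real.log_le_iff_le_exp hd, Finset.mem_range]
  have hfloor := Nat.floor_le (sub_nonneg.2 h₁)
  have hlt := Nat.lt_floor_add_one (Real.log d - L)
  by_cases hk : ⌊Real.log d - L⌋₊ < L
  · exact ⟨_, hk, by linarith, by linarith⟩
  · have hk' : (L : ℝ) ≤ ⌊Real.log d - L⌋₊ := by exact_mod_cast not_lt.1 hk
    refine ⟨L - 1, by omega, ?_, ?_⟩ <;> push_cast [Nat.cast_sub hL] <;> linarith

/-- The logarithmic cutoff gradient estimate: if `μ(B_r(o)) ≤ C r²` for all `r > 0`, and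
`g_L(x) = 1/(L·d(o,x))` on the annulus `e^L ≤ d(o,x) ≤ e^{2L}` and `0` elsewhere, then
`∫ g_L² dμ ≤ C e²/L`. -/
theorem log_cutoff_estimate {X : Type*} [MetricSpace X] [MeasurableSpace X] [BorelSpace X]
    (μ : Measure X) (o : X) (C : ℝ) (hC : 0 < C)
    (hμ : ∀ r : ℝ, 0 < r → μ (Metric.ball o r) ≤ ENNReal.ofReal (C * r ^ 2))
    (L : ℕ) (hL : 1 ≤ L) (g : X → ℝ)
    (hg : ∀ x, g x =
      if Real.exp L ≤ dist o x ∧ dist o x ≤ Real.exp (2 * L)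
      then 1 / (L * dist o x) else 0) :
    ∫⁻ x, ENNReal.ofReal ((g x) ^ 2) ∂μ ≤ ENNReal.ofReal (C * Real.exp 2 / L) := by
  have hL0 : (0 : ℝ) < L := by exact_mod_cast hL
  let c : ℕ → ℝ := fun k => (1 / (L * Real.exp (L + k))) ^ 2
  let B : ℕ → Set X := fun k => Metric.closedBall o (Real.exp (L + k + 1))
  have hpt : ∀ x, ENNReal.ofReal ((g x) ^ 2) ≤
      ∑ k ∈ Finset.range L, (B k).indicator (fun _ => ENNReal.ofReal (c k)) x := by
    intro x
    rw [hg]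
    split_ifs with hx
    · obtain ⟨k, hk, h₁, h₂⟩ := exists_exp_le_le_exp_succ hL hx.1 hx.2
      have hxB : x ∈ B k := by rwa [Metric.mem_closedBall']
      calc ENNReal.ofReal ((1 / (L * dist o x)) ^ 2)
          ≤ ENNReal.ofReal (c k) := by
            have hd : 0 < dist o x := (Real.exp_pos _).trans_le h₁
            refine ENNReal.ofReal_le_ofReal ?_
            dsimp only [c]
            gcongr
        _ = (B k).indicator (fun _ => ENNReal.ofReal (c k)) x :=
            (Set.indicator_of_mem hxB fun _ => ENNReal.ofReal (c k)).symm
        _ ≤ _ := Finset.single_le_sum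
            (f := fun k => (B k).indicator (fun _ => ENNReal.ofReal (c k)) x)
            (fun _ _ => zero_le) hk
    · simp
  have hball : ∀ k ∈ Finset.range L,
      ENNReal.ofReal (c k) * μ (B k) ≤ ENNReal.ofReal (C * Real.exp 2 / L ^ 2) := by
    intro k _
    calc ENNReal.ofReal (c k) * μ (B k)
        ≤ ENNReal.ofReal (c k) * ENNReal.ofReal (C * Real.exp (L + k + 1) ^ 2) := by
          gcongr
          exact measure_closedBall_le_of_measure_ball_le hμ (Real.exp_pos _).le
      _ = ENNReal.ofReal (C * Real.exp 2 / L ^ 2) := by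
          rw [← ENNReal.ofReal_mul (sq_nonneg _)]
          congr 1
          have h2 : Real.exp 2 = Real.exp 1 ^ 2 := by
            rw [← Real.exp_nat_mul]; norm_num
          rw [Real.exp_add (L + k) 1, h2]
          field_simp
  have hmeas : ∀ k, MeasurableSet (B k) := fun k => Metric.isClosed_closedBall.measurableSet
  calc ∫⁻ x, ENNReal.ofReal ((g x) ^ 2) ∂μ
      ≤ ∫⁻ x, ∑ k ∈ Finset.range L, (B k).indicator (fun _ => ENNReal.ofReal (c k)) x ∂μ :=
        lintegral_mono hpt
    _ = ∑ k ∈ Finset.range L, ENNReal.ofReal (c k) * μ (B k) := by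
        rw [lintegral_finsetSum _ fun k _ => measurable_const.indicator (hmeas k)]
        exact Finset.sum_congr rfl fun k _ => lintegral_indicator_const (hmeas k) _
    _ ≤ ∑ k ∈ Finset.range L, ENNReal.ofReal (C * Real.exp 2 / L ^ 2) :=
        Finset.sum_le_sum hball
    _ = ENNReal.ofReal (C * Real.exp 2 / L) := by
        rw [← ENNReal.ofReal_sum_of_nonneg fun _ _ => by positivity]
        congr 1
        rw [Finset.sum_const, Finset.card_range, nsmul_eq_mul]
        field_simp
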